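/- Let E be a set and suppose there exists a subadditive measure p on E with p(E) = 1 and p(F) = 0 for every finite F ⊆ E (that is, Card(E) is a g-sequential cardinal). Then the topological group Sym(E) of all permutations of E with the topology of pointwise convergence is not g-stable: the g-modification of its topology is strictly finer than the topology itself. -/

import Mathlib

open Filter Topology Set

universe u

/-- A subadditive measure on a set `A`. -/
def IsSubadditiveMeasure {A : Type*} (p : Set A → ℝ) : Prop :=
  (∀ B : Set A, 0 ≤ p B ∧ p B ≤ 1) ∧
  (∀ B C : Set A, Disjoint B C → p (B ∪ C) ≤ p B + p C) ∧
  (∀ S : ℕ → Set A, (∀ n, S (n + 1) ⊆ S n) → (⋂ n, S n) = ∅ →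
    Tendsto (fun n => p (S n)) atTop (𝓝 0))

/-- `Card(E)` is a g-sequential cardinal: there is a subadditive measure `p` on `E` with
`p(E) = 1` and `p(F) = 0` for every finite `F ⊆ E`. -/
def GSequentialCard (E : Type*) : Prop :=
  ∃ p : Set E → ℝ, IsSubadditiveMeasure p ∧ p Set.univ = 1 ∧
    ∀ F : Set E, F.Finite → p F = 0

/-- The g-modification of a topology `t`. -/
def gMod {X : Type u} (t : TopologicalSpace X) : TopologicalSpace X :=
  TopologicalSpace.generateFrom
    {W : Set X | ∃ (A : Type u) (U : A → Set X) (p : Set A → ℝ) (ε : ℝ),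
      (∀ α, IsOpen[t] (U α)) ∧ IsSubadditiveMeasure p ∧ 0 < ε ∧
      W = {x : X | p {α : A | x ∉ U α} < ε}}

/-- The topology of pointwise convergence on the permutation group `Sym(E)` of a set `E`:
the topology induced by the inclusion `Sym(E) → Eᴱ`, where `Eᴱ` carries the product of
discrete topologies. -/
def permTop (E : Type u) : TopologicalSpace (Equiv.Perm E) :=
  TopologicalSpace.induced (fun g : Equiv.Perm E => (g : E → E))
    (@Pi.topologicalSpace E (fun _ => E) (fun _ => ⊥))

/-- An infinite type has a permutation without fixed points. -/
theorem exists_perm_forall_ne (α : Type*) [Infinite α] :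
    ∃ g : Equiv.Perm α, ∀ x, g x ≠ x := by
  have h : Cardinal.mk (α ⊕ α) = Cardinal.mk α := by
    rw [Cardinal.mk_sum, Cardinal.lift_id, Cardinal.add_eq_self (Cardinal.aleph0_le_mk α)]
  obtain ⟨e⟩ := Cardinal.eq.1 h
  refine ⟨(e.symm.trans (Equiv.sumComm α α)).trans e, fun x hx => ?_⟩
  obtain ⟨y, rfl⟩ := e.surjective x
  rcases y with y | y <;> simp at hx

/-- In an infinite type, some permutation has the complement of a given finite set as the set
of its non-fixed points. -/
theorem exists_perm_setOf_ne_eq_compl {α : Type*} [Infinite α] (F : Finset α) :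
    ∃ g : Equiv.Perm α, {x | g x ≠ x} = (F : Set α)ᶜ := by
  classical
  have : Infinite {x // x ∉ F} := F.finite_toSet.infinite_compl.to_subtype
  obtain ⟨g, hg⟩ := exists_perm_forall_ne {x // x ∉ F}
  refine ⟨Equiv.Perm.ofSubtype g, ?_⟩
  ext x
  by_cases hx : x ∈ F
  · simp [Equiv.Perm.ofSubtype_apply_of_not_mem g (not_not.2 hx), hx]
  · have := hg ⟨x, hx⟩
    simpa [Equiv.Perm.ofSubtype_apply_of_mem g hx, hx, Subtype.ext_iff] using this

theorem isSubadditiveMeasure_indicator {A : Type*} (a : A) :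
    IsSubadditiveMeasure (fun S : Set A => S.indicator (fun _ => (1 : ℝ)) a) := by
  refine ⟨fun B => ?_, fun B C _ => ?_, fun S hS hempty => ?_⟩
  · by_cases h : a ∈ B <;> simp [h]
  · by_cases hB : a ∈ B <;> by_cases hC : a ∈ C <;> simp [hB, hC]
  · obtain ⟨n, hn⟩ : ∃ n, a ∉ S n := by
      have : a ∉ ⋂ n, S n := by simp [hempty]
      simpa using this
    refine tendsto_const_nhds.congr' ?_
    filter_upwards [eventually_ge_atTop n] with m hm
    have ha : a ∉ S m := fun h => hn (antitone_nat_of_succ_le hS hm h)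
    simp [ha]

theorem gMod_le {X : Type u} (t : TopologicalSpace X) : gMod t ≤ t := by
  intro V hV
  refine TopologicalSpace.isOpen_generateFrom_of_mem
    ⟨PUnit, fun _ => V, _, 1, fun _ => hV, isSubadditiveMeasure_indicator PUnit.unit,
      one_pos, ?_⟩
  ext x
  by_cases hx : x ∈ V <;> simp [hx]

theorem isOpen_permTop_setOf_apply_eq {E : Type u} (a b : E) :
    IsOpen[permTop E] {g : Equiv.Perm E | g a = b} := by
  let _ : TopologicalSpace E := ⊥
  have : DiscreteTopology E := ⟨rfl⟩
  exact isOpen_induced_iff.2 ⟨{f | f a = b},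
    (isOpen_discrete ({b} : Set E)).preimage
      (continuous_apply a : Continuous fun f : E → E => f a), rfl⟩

/-- A neighbourhood of the identity in the topology of pointwise convergence contains the
pointwise stabilizer of a finite set. -/
theorem exists_finset_of_isOpen_permTop {E : Type u} {W : Set (Equiv.Perm E)}
    (hW : IsOpen[permTop E] W) (h1 : 1 ∈ W) :
    ∃ F : Finset E, ∀ g : Equiv.Perm E, (∀ x ∈ F, g x = x) → g ∈ W := by
  let _ : TopologicalSpace E := ⊥
  obtain ⟨V, hV, rfl⟩ := isOpen_induced_iff.1 hW
  obtain ⟨F, u, hu, hsub⟩ := isOpen_pi_iff.1 hV _ h1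
  refine ⟨F, fun g hg => hsub fun x hx => ?_⟩
  have := (hu x hx).2
  simpa [hg x hx] using this

/-- if `Card(E)` is a g-sequential cardinal, then `Sym(E)` with the topology of
pointwise convergence is not g-stable: the g-modification of its topology is strictly finer
than the topology itself. -/
theorem sym_not_gStable {E : Type u} (hE : GSequentialCard E) :
    gMod (permTop E) < permTop E := by
  obtain ⟨p, hp, huniv, hfin⟩ := hE
  have : Infinite E := by
    refine ⟨fun _ => ?_⟩
    linarith [hfin univ (toFinite _)]
  refine lt_of_le_not_ge (gMod_le _) fun hle => ?_
  have hW : IsOpen[permTop E] {g : Equiv.Perm E | p {a | g ∉ {f : Equiv.Perm E | f a = a}} < 1} :=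
    hle _ (TopologicalSpace.isOpen_generateFrom_of_mem
      ⟨E, _, p, 1, fun a => isOpen_permTop_setOf_apply_eq a a, hp, one_pos, rfl⟩)
  obtain ⟨F, hF⟩ := exists_finset_of_isOpen_permTop hW (by simp [hfin ∅ finite_empty])
  obtain ⟨g, hg⟩ := exists_perm_setOf_ne_eq_compl F
  have hlt : p (F : Set E)ᶜ < 1 := by
    rw [← hg]
    refine hF g fun x hx => ?_
    by_contra hne
    have : x ∈ (F : Set E)ᶜ := hg ▸ hne
    exact this hx
  have hadd := hp.2.1 F (F : Set E)ᶜ disjoint_compl_right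
  rw [union_compl_self, huniv, hfin F F.finite_toSet] at hadd
  linarith
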